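/- Let B be an n×m real matrix, R an m×m real symmetric positive definite matrix, W an n×n real symmetric positive semidefinite matrix, and let M₁ and M₂ be n×n real symmetric positive semidefinite matrices. Then tr( (g(B,R,M₁) − g(B,R,M₂)) W ) ≤ ‖M₁ − M₂‖_F · ‖H(B,R,M₂)ᵀ W H(B,R,M₂)‖_F, where ‖·‖_F is the Frobenius norm. -/

import Mathlib

open Matrix

/-- The Frobenius norm of a real matrix. -/
noncomputable def frob {n m : ℕ} (M : Matrix (Fin n) (Fin m) ℝ) : ℝ :=
  Real.sqrt (∑ i, ∑ j, (M i j) ^ 2)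

/-- The Riccati-type update `g(B,R,M) = M − M B (Bᵀ M B + R)⁻¹ Bᵀ M`. -/
noncomputable def g {n m : ℕ} (B : Matrix (Fin n) (Fin m) ℝ)
    (R : Matrix (Fin m) (Fin m) ℝ) (M : Matrix (Fin n) (Fin n) ℝ) :
    Matrix (Fin n) (Fin n) ℝ :=
  M - M * B * (Bᵀ * M * B + R)⁻¹ * Bᵀ * M

/-- `H(B,R,M) = I − M B (Bᵀ M B + R)⁻¹ Bᵀ`. -/
noncomputable def H {n m : ℕ} (B : Matrix (Fin n) (Fin m) ℝ)
    (R : Matrix (Fin m) (Fin m) ℝ) (M : Matrix (Fin n) (Fin n) ℝ) :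
    Matrix (Fin n) (Fin n) ℝ :=
  1 - M * B * (Bᵀ * M * B + R)⁻¹ * Bᵀ

theorem aux_complete_square {n m : ℕ} (B : Matrix (Fin n) (Fin m) ℝ)
    (R : Matrix (Fin m) (Fin m) ℝ) (hR : R.PosDef)
    (M : Matrix (Fin n) (Fin n) ℝ) (hM : M.PosSemidef) (K : Matrix (Fin n) (Fin m) ℝ) :
    (1 - K * Bᵀ) * M * (1 - K * Bᵀ)ᵀ + K * R * Kᵀ =
      g B R M + (K - M * B * (Bᵀ * M * B + R)⁻¹) * (Bᵀ * M * B + R) *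
        (K - M * B * (Bᵀ * M * B + R)⁻¹)ᵀ := by
  have hMt : Mᵀ = M := by simpa using hM.isHermitian.eq
  have hRt : Rᵀ = R := by simpa using hR.isHermitian.eq
  have hS : (Bᵀ * M * B + R).PosDef := by
    have h := hM.conjTranspose_mul_mul_same B
    rw [conjTranspose_eq_transpose_of_trivial] at h
    exact Matrix.PosDef.posSemidef_add h hR
  have hdet : IsUnit (Bᵀ * M * B + R).det := hS.det_pos.ne'.isUnit
  have hL : (1 - K * Bᵀ) * M * (1 - K * Bᵀ)ᵀ + K * R * Kᵀ =
      M - K * (Bᵀ * M) - M * B * Kᵀ + K * (Bᵀ * M * B + R) * Kᵀ := by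
    simp only [transpose_sub, transpose_one, transpose_mul, transpose_transpose,
      Matrix.sub_mul, Matrix.mul_sub, Matrix.mul_add, Matrix.add_mul, Matrix.one_mul,
      Matrix.mul_one, Matrix.mul_assoc]
    abel
  have hSt : (Bᵀ * M * B + R)ᵀ = Bᵀ * M * B + R := by simpa using hS.isHermitian.eq
  rw [hL, g]
  generalize Bᵀ * M * B + R = S at *
  have h1 : (S⁻¹)ᵀ = S⁻¹ := by rw [transpose_nonsing_inv, hSt]
  have e1 : (K - M * B * S⁻¹) * S = K * S - M * B := by
    rw [Matrix.sub_mul, Matrix.nonsing_inv_mul_cancel_right _ _ hdet]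
  have e2 : (K - M * B * S⁻¹)ᵀ = Kᵀ - S⁻¹ * (Bᵀ * M) := by
    simp [transpose_mul, h1, hMt]
  have e3 : K * S * (S⁻¹ * (Bᵀ * M)) = K * (Bᵀ * M) := by
    rw [Matrix.mul_assoc, Matrix.mul_nonsing_inv_cancel_left _ _ hdet]
  rw [e1, e2, Matrix.mul_sub, Matrix.sub_mul, Matrix.sub_mul, e3]
  simp only [Matrix.mul_assoc]
  abel

open scoped MatrixOrder Matrix.Norms.L2Operator in
theorem aux_trace_nonneg {n m : ℕ} (X : Matrix (Fin n) (Fin m) ℝ)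
    (S : Matrix (Fin m) (Fin m) ℝ) (hS : S.PosSemidef)
    (W : Matrix (Fin n) (Fin n) ℝ) (hW : W.PosSemidef) :
    0 ≤ (X * S * Xᵀ * W).trace := by
  have h1 := hW.conjTranspose_mul_mul_same X
  rw [conjTranspose_eq_transpose_of_trivial] at h1
  obtain ⟨V, hV⟩ : ∃ V : Matrix (Fin m) (Fin m) ℝ, S = Vᴴ * V :=
    CStarAlgebra.nonneg_iff_eq_star_mul_self.mp hS.nonneg
  have h2 := (h1.mul_mul_conjTranspose_same V).trace_nonneg
  have : (X * S * Xᵀ * W).trace = (V * (Xᵀ * W * X) * Vᴴ).trace := by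
    rw [hV, Matrix.trace_mul_comm (V * (Xᵀ * W * X)), Matrix.mul_assoc X, Matrix.mul_assoc X,
      Matrix.trace_mul_comm X]
    simp only [Matrix.mul_assoc]
  rwa [this]

theorem aux_cs {n : ℕ} (D A : Matrix (Fin n) (Fin n) ℝ) :
    (D * A).trace ≤ frob D * frob A := by
  have h := Real.sum_mul_le_sqrt_mul_sqrt (Finset.univ : Finset (Fin n × Fin n))
    (fun p => D p.1 p.2) (fun p => A p.2 p.1)
  simp only [Fintype.sum_prod_type] at h
  rw [Finset.sum_comm (f := fun i j => A j i ^ 2)] at h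
  simpa [frob, Matrix.trace, Matrix.mul_apply] using h

/-- trace perturbation bound,
`tr((g(B,R,M₁) − g(B,R,M₂)) W) ≤ ‖M₁ − M₂‖_F ‖H(B,R,M₂)ᵀ W H(B,R,M₂)‖_F`. -/
theorem trace_g_diff_le {n m : ℕ}
    (B : Matrix (Fin n) (Fin m) ℝ) (R : Matrix (Fin m) (Fin m) ℝ)
    (hR : R.PosDef)
    (W : Matrix (Fin n) (Fin n) ℝ) (hW : W.PosSemidef)
    (M₁ M₂ : Matrix (Fin n) (Fin n) ℝ)
    (hM₁ : M₁.PosSemidef) (hM₂ : M₂.PosSemidef) :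
    ((g B R M₁ - g B R M₂) * W).trace ≤
      frob (M₁ - M₂) * frob ((H B R M₂)ᵀ * W * H B R M₂) := by
  have a1 := aux_complete_square B R hR M₁ hM₁ (M₂ * B * (Bᵀ * M₂ * B + R)⁻¹)
  have a2 := aux_complete_square B R hR M₂ hM₂ (M₂ * B * (Bᵀ * M₂ * B + R)⁻¹)
  have hS : (Bᵀ * M₁ * B + R).PosSemidef := by
    have h := hM₁.conjTranspose_mul_mul_same B
    rw [conjTranspose_eq_transpose_of_trivial] at h
    exact h.add hR.posSemidef
  have hn := aux_trace_nonneg (M₂ * B * (Bᵀ * M₂ * B + R)⁻¹ - M₁ * B * (Bᵀ * M₁ * B + R)⁻¹)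
    _ hS W hW
  rw [sub_self, Matrix.zero_mul, Matrix.zero_mul, add_zero] at a2
  change H B R M₂ * M₁ * (H B R M₂)ᵀ + _ = _ at a1
  change H B R M₂ * M₂ * (H B R M₂)ᵀ + _ = _ at a2
  refine le_trans ?_ (aux_cs _ _)
  have key : g B R M₁ - g B R M₂ = H B R M₂ * (M₁ - M₂) * (H B R M₂)ᵀ -
      (M₂ * B * (Bᵀ * M₂ * B + R)⁻¹ - M₁ * B * (Bᵀ * M₁ * B + R)⁻¹) * (Bᵀ * M₁ * B + R) *
      (M₂ * B * (Bᵀ * M₂ * B + R)⁻¹ - M₁ * B * (Bᵀ * M₁ * B + R)⁻¹)ᵀ := by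
    rw [← a2, eq_sub_of_add_eq a1.symm, Matrix.mul_sub (H B R M₂) M₁ M₂,
      Matrix.sub_mul (H B R M₂ * M₁)]
    abel
  have ht : (H B R M₂ * (M₁ - M₂) * (H B R M₂)ᵀ * W).trace =
      ((M₁ - M₂) * ((H B R M₂)ᵀ * W * H B R M₂)).trace := by
    rw [Matrix.mul_assoc, Matrix.mul_assoc, Matrix.trace_mul_comm]
    simp only [Matrix.mul_assoc]
  rw [key, Matrix.sub_mul, Matrix.trace_sub, ht]
  linarith
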